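/- Let 0 < p < ∞ and let ψ : ℤ⁺ → ℝ be a non-negative sequence whose partial sums Ψ(n) = Σ_{τ=1}^{n} ψ(τ) are positive for all n. Then there is a constant C > 0 such that Σ_{n=1}^{∞} (A_ψ y)^p(n) v(n) ≤ C·Σ_{n=1}^{∞} y^p(n) v(n) holds for all non-negative non-increasing sequences y if and only if there is a constant C' > 0 such that the weight sequence v satisfies Σ_{k=n}^{∞} (Ψ(n)/Ψ(k))^p v(k) ≤ C'·Σ_{k=1}^{n} v(k) for all n ∈ ℤ⁺. -/

import Mathlib

/-- Partial sums `Ψ(n) = Σ_{τ=1}^n ψ(τ)`. -/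
noncomputable def PsiSum (ψ : ℕ → ℝ) (n : ℕ) : ℝ := ∑ τ ∈ Finset.Icc 1 n, ψ τ

/-- The generalized discrete Hardy averaging operator
`(A_ψ f)(n) = (1/Ψ(n)) Σ_{τ=1}^n f(τ) ψ(τ)`. -/
noncomputable def hardyAvg (ψ f : ℕ → ℝ) (n : ℕ) : ℝ :=
  (1 / PsiSum ψ n) * ∑ τ ∈ Finset.Icc 1 n, f τ * ψ τ

/-- Reindexing of a sum over `1, …, n` as a sum over `0, …, n - 1`. -/
lemma sum_Icc_one_eq_sum_range (f : ℕ → ℝ) (n : ℕ) :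
    ∑ k ∈ Finset.Icc 1 n, f k = ∑ i ∈ Finset.range n, f (i + 1) := by
  induction n with
  | zero => simp
  | succ n ih => rw [Finset.sum_Icc_succ_top (by omega), ih, Finset.sum_range_succ]

lemma psiSum_zero (ψ : ℕ → ℝ) : PsiSum ψ 0 = 0 := by simp [PsiSum]

lemma psiSum_succ (ψ : ℕ → ℝ) (n : ℕ) : PsiSum ψ (n + 1) = PsiSum ψ n + ψ (n + 1) := by
  rw [PsiSum, PsiSum, Finset.sum_Icc_succ_top (by omega)]

lemma psiSum_mono {ψ : ℕ → ℝ} (hψ : ∀ k, 0 ≤ ψ k) : Monotone (PsiSum ψ) :=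
  monotone_nat_of_le_succ fun n => by rw [psiSum_succ]; linarith [hψ (n + 1)]

lemma psiSum_nonneg {ψ : ℕ → ℝ} (hψ : ∀ k, 0 ≤ ψ k) (n : ℕ) : 0 ≤ PsiSum ψ n :=
  Finset.sum_nonneg fun _ _ => hψ _

/-- Abel summation: a sequence with non-negative partial sums keeps a non-negative sum after
multiplication by a non-negative non-increasing sequence. -/
lemma sum_mul_nonneg_of_antitone {g c : ℕ → ℝ} {N : ℕ} (hg : Antitone g) (hg0 : ∀ i, 0 ≤ g i)
    (hc : ∀ m ≤ N, 0 ≤ ∑ i ∈ Finset.range m, c i) :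
    0 ≤ ∑ i ∈ Finset.range N, g i * c i := by
  have key : ∀ m ≤ N, g m * ∑ i ∈ Finset.range m, c i ≤ ∑ i ∈ Finset.range m, g i * c i := by
    intro m
    induction m with
    | zero => simp
    | succ m ih =>
      intro hm
      have h1 := ih (by omega)
      have h2 := mul_le_mul_of_nonneg_right (hg (Nat.le_succ m)) (hc (m + 1) hm)
      rw [Finset.sum_range_succ] at h2
      rw [Finset.sum_range_succ, Finset.sum_range_succ]
      simp only [Nat.succ_eq_add_one] at h2
      linarith
  exact (mul_nonneg (hg0 N) (hc N le_rfl)).trans (key N le_rfl)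

/-- A weighted linear Hardy-type inequality for non-increasing sequences, reduced to
its validity on initial segments. -/
lemma sum_weighted_increment_le {P w g : ℕ → ℝ} {C : ℝ} {N : ℕ}
    (hP0 : P 0 = 0) (hP : ∀ i, 0 < P (i + 1)) (hw : ∀ i, 0 ≤ w i)
    (hg : Antitone g) (hg0 : ∀ i, 0 ≤ g i)
    (hC : ∀ m, ∑ k ∈ Finset.Ico m N, P (m + 1) / P (k + 1) * w k ≤
      C * ∑ i ∈ Finset.range (m + 1), w i) :
    ∑ n ∈ Finset.range N, w n / P (n + 1) *
        ∑ i ∈ Finset.range (n + 1), g i * (P (i + 1) - P i) ≤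
      (1 + C) * ∑ i ∈ Finset.range N, g i * w i := by
  set W : ℕ → ℝ := fun m => ∑ k ∈ Finset.Ico m N, w k / P (k + 1) with hW
  have swap : ∑ n ∈ Finset.range N, w n / P (n + 1) *
        ∑ i ∈ Finset.range (n + 1), g i * (P (i + 1) - P i) =
      ∑ i ∈ Finset.range N, g i * ((P (i + 1) - P i) * W i) := by
    simp only [hW, Finset.mul_sum]
    rw [Finset.sum_comm' (t' := Finset.range N) (s' := fun i => Finset.Ico i N)]
    · refine Finset.sum_congr rfl fun i _ => Finset.sum_congr rfl fun k _ => by ring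
    · intro x y
      simp only [Finset.mem_range, Finset.mem_Ico]
      omega
  have hWsucc : ∀ m < N, W m = w m / P (m + 1) + W (m + 1) := fun m hm =>
    Finset.sum_eq_sum_Ico_succ_bot hm _
  have partialSum : ∀ m ≤ N, ∑ i ∈ Finset.range m, (P (i + 1) - P i) * W i =
      P m * W m + ∑ i ∈ Finset.range m, w i := by
    intro m
    induction m with
    | zero => simp [hP0]
    | succ m ih =>
      intro hm
      rw [Finset.sum_range_succ, Finset.sum_range_succ, ih (by omega), hWsucc m (by omega)]
      have := (hP m).ne'
      field_simp
      ring
  have bound : ∀ m ≤ N, P m * W m ≤ C * ∑ i ∈ Finset.range m, w i := by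
    intro m hm
    cases m with
    | zero => simp [hP0]
    | succ m =>
      refine le_trans ?_ (hC m)
      rw [hW, Finset.mul_sum, Finset.sum_eq_sum_Ico_succ_bot (by omega : m < N)]
      have h0 : 0 ≤ P (m + 1) / P (m + 1) * w m :=
        mul_nonneg (div_nonneg (hP m).le (hP m).le) (hw m)
      have h1 : ∑ k ∈ Finset.Ico (m + 1) N, P (m + 1) * (w k / P (k + 1)) =
          ∑ k ∈ Finset.Ico (m + 1) N, P (m + 1) / P (k + 1) * w k :=
        Finset.sum_congr rfl fun k _ => by ring
      linarith
  have h := sum_mul_nonneg_of_antitone (N := N)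
    (c := fun i => (1 + C) * w i - (P (i + 1) - P i) * W i) hg hg0 (by
      intro m hm
      rw [Finset.sum_sub_distrib, ← Finset.mul_sum, partialSum m hm]
      linarith [bound m hm])
  rw [swap, Finset.mul_sum]
  simp only [mul_sub, Finset.sum_sub_distrib] at h
  have h2 : ∑ i ∈ Finset.range N, g i * ((1 + C) * w i) =
      ∑ i ∈ Finset.range N, (1 + C) * (g i * w i) :=
    Finset.sum_congr rfl fun i _ => by ring
  linarith

/-- Increments of `x ↦ x ^ p` decrease for `p ≤ 1`. -/
lemma rpow_add_sub_rpow_le {p s t a : ℝ} (hp0 : 0 ≤ p) (hp1 : p ≤ 1) (ht : 0 ≤ t) (hts : t ≤ s)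
    (ha : 0 ≤ a) : (s + a) ^ p - s ^ p ≤ (t + a) ^ p - t ^ p := by
  rcases hts.eq_or_lt with rfl | hlt
  · exact le_rfl
  have hd : 0 < s - t + a := by linarith
  have hconc := Real.concaveOn_rpow hp0 hp1
  have hsum : (s - t) / (s - t + a) + a / (s - t + a) = 1 := by field_simp
  have hmt : t ∈ Set.Ici (0 : ℝ) := ht
  have hms : s + a ∈ Set.Ici (0 : ℝ) := by
    simp only [Set.mem_Ici]
    linarith
  have hu : 0 ≤ (s - t) / (s - t + a) := div_nonneg (by linarith) hd.le
  have hv : 0 ≤ a / (s - t + a) := div_nonneg ha hd.le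
  have h1 := hconc.2 hmt hms hu hv hsum
  have h2 := hconc.2 hmt hms hv hu (by linarith)
  simp only [smul_eq_mul] at h1 h2
  rw [show (s - t) / (s - t + a) * t + a / (s - t + a) * (s + a) = t + a by
    field_simp; ring] at h1
  rw [show a / (s - t + a) * t + (s - t) / (s - t + a) * (s + a) = s by
    field_simp; ring] at h2
  have h3 : (s - t) / (s - t + a) = 1 - a / (s - t + a) := by linarith
  rw [h3] at h1 h2
  linarith

/-- The tangent line inequality for the convex function `x ↦ x ^ p`, `1 ≤ p`. -/
lemma rpow_sub_rpow_le_mul {p r s : ℝ} (hp : 1 ≤ p) (hr : 0 ≤ r) (hrs : r ≤ s) :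
    s ^ p - r ^ p ≤ p * s ^ (p - 1) * (s - r) := by
  rcases (hr.trans hrs).eq_or_lt with rfl | hs
  · obtain rfl : r = 0 := le_antisymm hrs hr
    simp
  have h := one_add_mul_self_le_rpow_one_add (s := r / s - 1)
    (by linarith [div_nonneg hr hs.le]) hp
  rw [add_sub_cancel, Real.div_rpow hr hs.le, le_div_iff₀ (Real.rpow_pos_of_pos hs p)] at h
  have h2 : s ^ p = s ^ (p - 1) * s := by
    rw [← Real.rpow_add_one hs.ne', sub_add_cancel]
  have h3 : (1 + p * (r / s - 1)) * s ^ p = s ^ p - p * s ^ (p - 1) * (s - r) := by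
    rw [h2]
    field_simp
    ring
  linarith

section Averages

variable {ψ y : ℕ → ℝ}

lemma hardyAvg_nonneg (hψ : ∀ k, 0 ≤ ψ k) (hy0 : ∀ k, 0 ≤ y k) (n : ℕ) : 0 ≤ hardyAvg ψ y n :=
  mul_nonneg (one_div_nonneg.2 (psiSum_nonneg hψ n))
    (Finset.sum_nonneg fun _ _ => mul_nonneg (hy0 _) (hψ _))

/-- The average times its normalisation is the weighted sum, also at `n = 0`. -/
lemma psiSum_mul_hardyAvg (hΨpos : ∀ n : ℕ, 1 ≤ n → 0 < PsiSum ψ n) (n : ℕ) :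
    PsiSum ψ n * hardyAvg ψ y n = ∑ τ ∈ Finset.Icc 1 n, y τ * ψ τ := by
  rcases Nat.eq_zero_or_pos n with rfl | hn
  · simp [psiSum_zero]
  · rw [hardyAvg, ← mul_assoc, mul_one_div_cancel (hΨpos n hn).ne', one_mul]

lemma mul_psiSum_le_sum (hψ : ∀ k, 0 ≤ ψ k)
    (hy : ∀ j k : ℕ, 1 ≤ j → j ≤ k → y k ≤ y j) {n m : ℕ} (hnm : n ≤ m) :
    y m * PsiSum ψ n ≤ ∑ τ ∈ Finset.Icc 1 n, y τ * ψ τ := by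
  rw [PsiSum, Finset.mul_sum]
  refine Finset.sum_le_sum fun τ hτ => ?_
  rw [Finset.mem_Icc] at hτ
  exact mul_le_mul_of_nonneg_right (hy τ m hτ.1 (hτ.2.trans hnm)) (hψ τ)

lemma antitone_hardyAvg_succ (hψ : ∀ k, 0 ≤ ψ k) (hΨpos : ∀ n : ℕ, 1 ≤ n → 0 < PsiSum ψ n)
    (hy : ∀ j k : ℕ, 1 ≤ j → j ≤ k → y k ≤ y j) : Antitone fun n => hardyAvg ψ y (n + 1) := by
  refine antitone_nat_of_succ_le fun n => ?_
  have h1 := hΨpos (n + 1) (by omega)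
  have h2 := hΨpos (n + 1 + 1) (by omega)
  have h3 := mul_psiSum_le_sum hψ hy (Nat.le_succ (n + 1))
  have h4 := mul_le_mul_of_nonneg_right h3 (hψ (n + 1 + 1))
  rw [hardyAvg, hardyAvg, one_div_mul_eq_div, one_div_mul_eq_div, div_le_div_iff₀ h2 h1,
    Finset.sum_Icc_succ_top (by omega), psiSum_succ ψ (n + 1)]
  simp only [Nat.succ_eq_add_one] at h4
  linarith

lemma sum_rpow_le_of_le_one {p : ℝ} (hp0 : 0 < p) (hp1 : p ≤ 1) (hψ : ∀ k, 0 ≤ ψ k)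
    (hy0 : ∀ k, 0 ≤ y k) (hy : ∀ j k : ℕ, 1 ≤ j → j ≤ k → y k ≤ y j) (n : ℕ) :
    (∑ τ ∈ Finset.Icc 1 n, y τ * ψ τ) ^ p ≤
      ∑ i ∈ Finset.range n, y (i + 1) ^ p * (PsiSum ψ (i + 1) ^ p - PsiSum ψ i ^ p) := by
  induction n with
  | zero => simp [Real.zero_rpow hp0.ne']
  | succ n ih =>
    rw [Finset.sum_range_succ, Finset.sum_Icc_succ_top (by omega), mul_sub,
      ← Real.mul_rpow (hy0 _) (psiSum_nonneg hψ _), ← Real.mul_rpow (hy0 _) (psiSum_nonneg hψ _),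
      psiSum_succ, mul_add]
    have h := rpow_add_sub_rpow_le hp0.le hp1 (mul_nonneg (hy0 (n + 1)) (psiSum_nonneg hψ n))
      (mul_psiSum_le_sum hψ hy (Nat.le_succ n)) (mul_nonneg (hy0 (n + 1)) (hψ (n + 1)))
    linarith

lemma sum_rpow_le_of_one_le {p : ℝ} (hp1 : 1 ≤ p) (hψ : ∀ k, 0 ≤ ψ k)
    (hΨpos : ∀ n : ℕ, 1 ≤ n → 0 < PsiSum ψ n) (hy0 : ∀ k, 0 ≤ y k) (n : ℕ) :
    (∑ τ ∈ Finset.Icc 1 n, y τ * ψ τ) ^ p ≤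
      p * ∑ i ∈ Finset.range n, y (i + 1) * hardyAvg ψ y (i + 1) ^ (p - 1) *
        (PsiSum ψ (i + 1) ^ p - PsiSum ψ i ^ p) := by
  induction n with
  | zero => simp [Real.zero_rpow (by linarith : p ≠ 0)]
  | succ n ih =>
    have hs0 : 0 ≤ ∑ τ ∈ Finset.Icc 1 n, y τ * ψ τ :=
      Finset.sum_nonneg fun _ _ => mul_nonneg (hy0 _) (hψ _)
    have hyψ : 0 ≤ y (n + 1) * ψ (n + 1) := mul_nonneg (hy0 _) (hψ _)
    have hsucc := Finset.sum_Icc_succ_top (by omega : 1 ≤ n + 1) fun τ => y τ * ψ τ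
    have h1 := rpow_sub_rpow_le_mul hp1 hs0
      (by rw [hsucc]; linarith : _ ≤ ∑ τ ∈ Finset.Icc 1 (n + 1), y τ * ψ τ)
    have hΨ := hΨpos (n + 1) (by omega)
    have hA := hardyAvg_nonneg hψ hy0 (n + 1)
    have h2 : PsiSum ψ (n + 1) ^ (p - 1) * ψ (n + 1) ≤
        PsiSum ψ (n + 1) ^ p - PsiSum ψ n ^ p := by
      have hn0 := psiSum_nonneg hψ n
      have e1 : PsiSum ψ (n + 1) ^ p = PsiSum ψ (n + 1) ^ (p - 1) * PsiSum ψ (n + 1) := by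
        rw [← Real.rpow_add_one hΨ.ne', sub_add_cancel]
      have e2 : PsiSum ψ n ^ p ≤ PsiSum ψ (n + 1) ^ (p - 1) * PsiSum ψ n := by
        rcases hn0.eq_or_lt with h0 | h0
        · rw [← h0, Real.zero_rpow (by linarith : p ≠ 0), mul_zero]
        · calc PsiSum ψ n ^ p = PsiSum ψ n ^ (p - 1) * PsiSum ψ n := by
                rw [← Real.rpow_add_one h0.ne', sub_add_cancel]
            _ ≤ _ := mul_le_mul_of_nonneg_right (Real.rpow_le_rpow hn0
                (psiSum_mono hψ (Nat.le_succ n)) (by linarith)) hn0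
      have e3 : ψ (n + 1) = PsiSum ψ (n + 1) - PsiSum ψ n := by rw [psiSum_succ]; ring
      rw [e1, e3]
      linarith
    have h3 := mul_le_mul_of_nonneg_left h2
      (mul_nonneg (by linarith : 0 ≤ p) (mul_nonneg (hy0 (n + 1)) (Real.rpow_nonneg hA (p - 1))))
    rw [← psiSum_mul_hardyAvg hΨpos (n + 1), Real.mul_rpow hΨ.le hA (z := p - 1),
      psiSum_mul_hardyAvg hΨpos (n + 1)] at h1
    rw [show ∑ τ ∈ Finset.Icc 1 (n + 1), y τ * ψ τ - ∑ τ ∈ Finset.Icc 1 n, y τ * ψ τ =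
      y (n + 1) * ψ (n + 1) by rw [hsucc]; ring] at h1
    rw [Finset.sum_range_succ, mul_add]
    linarith

/-- Boundedness of the averages follows from a pointwise bound of `(Σ y ψ) ^ p` by a linear
expression in a non-increasing sequence. -/
lemma sum_hardyAvg_rpow_le {p K C : ℝ} {v h : ℕ → ℝ} {N : ℕ} (hp : 0 < p) (hψ : ∀ k, 0 ≤ ψ k)
    (hΨpos : ∀ n : ℕ, 1 ≤ n → 0 < PsiSum ψ n) (hv : ∀ k, 0 ≤ v k) (hy0 : ∀ k, 0 ≤ y k)
    (hK : 0 ≤ K) (hh : Antitone h) (hh0 : ∀ i, 0 ≤ h i)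
    (hbound : ∀ n, (∑ τ ∈ Finset.Icc 1 n, y τ * ψ τ) ^ p ≤
      K * ∑ i ∈ Finset.range n, h i * (PsiSum ψ (i + 1) ^ p - PsiSum ψ i ^ p))
    (hC : ∀ m, ∑ k ∈ Finset.Ico m N, (PsiSum ψ (m + 1) / PsiSum ψ (k + 1)) ^ p * v (k + 1) ≤
      C * ∑ i ∈ Finset.range (m + 1), v (i + 1)) :
    ∑ n ∈ Finset.range N, hardyAvg ψ y (n + 1) ^ p * v (n + 1) ≤
      K * (1 + C) * ∑ i ∈ Finset.range N, h i * v (i + 1) := by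
  have hmain := sum_weighted_increment_le (P := fun n => PsiSum ψ n ^ p)
    (w := fun i => v (i + 1)) (g := h) (C := C) (N := N)
    (by simp [psiSum_zero, Real.zero_rpow hp.ne'])
    (fun i => Real.rpow_pos_of_pos (hΨpos _ (by omega)) p) (fun i => hv _) hh hh0 (by
      intro m
      refine le_trans (le_of_eq (Finset.sum_congr rfl fun k _ => ?_)) (hC m)
      rw [Real.div_rpow (psiSum_nonneg hψ _) (psiSum_nonneg hψ _)])
  rw [mul_assoc]
  refine le_trans ?_ (mul_le_mul_of_nonneg_left hmain hK)
  rw [Finset.mul_sum]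
  refine Finset.sum_le_sum fun n _ => ?_
  have hΨ := hΨpos (n + 1) (by omega)
  have hw : 0 ≤ v (n + 1) / PsiSum ψ (n + 1) ^ p :=
    div_nonneg (hv _) (Real.rpow_nonneg hΨ.le p)
  have h1 := mul_le_mul_of_nonneg_left (hbound (n + 1)) hw
  have h2 : hardyAvg ψ y (n + 1) ^ p * v (n + 1) = v (n + 1) / PsiSum ψ (n + 1) ^ p *
      (∑ τ ∈ Finset.Icc 1 (n + 1), y τ * ψ τ) ^ p := by
    rw [← psiSum_mul_hardyAvg hΨpos, Real.mul_rpow hΨ.le (hardyAvg_nonneg hψ hy0 _)]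
    have := (Real.rpow_pos_of_pos hΨ p).ne'
    field_simp
  rw [h2]
  linarith

end Averages

/-- A form of Young's inequality which absorbs half of `a ^ p`. -/
lemma mul_mul_rpow_le {p K x a : ℝ} (hp : 1 ≤ p) (hK : 0 ≤ K) (hx : 0 ≤ x) (ha : 0 ≤ a) :
    K * (x * a ^ (p - 1)) ≤ K * (2 * K) ^ (p - 1) * x ^ p + a ^ p / 2 := by
  have hpow : ∀ {b : ℝ}, 0 ≤ b → b * b ^ (p - 1) = b ^ p := fun hb => by
    rw [mul_comm, ← Real.rpow_add_one' hb (by linarith), sub_add_cancel]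
  have ha' := Real.rpow_nonneg ha p
  rcases le_total a (2 * K * x) with h | h
  · have h1 : a ^ (p - 1) ≤ (2 * K) ^ (p - 1) * x ^ (p - 1) := by
      rw [← Real.mul_rpow (by linarith) hx]
      exact Real.rpow_le_rpow ha h (by linarith)
    have h2 := mul_le_mul_of_nonneg_left h1 (mul_nonneg hK hx)
    have h3 : K * x * ((2 * K) ^ (p - 1) * x ^ (p - 1)) = K * (2 * K) ^ (p - 1) * x ^ p := by
      rw [← hpow hx]
      ring
    linarith
  · have h1 := mul_le_mul_of_nonneg_right h (Real.rpow_nonneg ha (p - 1))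
    rw [hpow ha] at h1
    have h2 : 0 ≤ K * (2 * K) ^ (p - 1) * x ^ p := by positivity
    linarith

/-- Truncated form of the boundedness of the averaging operator, with a constant independent of
the truncation. -/
lemma exists_sum_hardyAvg_rpow_le {p C : ℝ} {ψ v : ℕ → ℝ} (hp : 0 < p) (hC0 : 0 < C)
    (hψ : ∀ k, 0 ≤ ψ k) (hΨpos : ∀ n : ℕ, 1 ≤ n → 0 < PsiSum ψ n) (hv : ∀ k, 0 ≤ v k)
    (hC : ∀ N m, ∑ k ∈ Finset.Ico m N,
      (PsiSum ψ (m + 1) / PsiSum ψ (k + 1)) ^ p * v (k + 1) ≤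
        C * ∑ i ∈ Finset.range (m + 1), v (i + 1)) :
    ∃ D : ℝ, 0 < D ∧ ∀ y : ℕ → ℝ, (∀ k, 0 ≤ y k) → (∀ j k : ℕ, 1 ≤ j → j ≤ k → y k ≤ y j) →
      ∀ N, ∑ n ∈ Finset.range N, hardyAvg ψ y (n + 1) ^ p * v (n + 1) ≤
        D * ∑ n ∈ Finset.range N, y (n + 1) ^ p * v (n + 1) := by
  rcases le_total p 1 with hp1 | hp1
  · refine ⟨1 * (1 + C), by linarith, fun y hy0 hy N => ?_⟩
    refine sum_hardyAvg_rpow_le (h := fun i => y (i + 1) ^ p) hp hψ hΨpos hv hy0 zero_le_one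
      (fun i j hij => ?_) (fun i => Real.rpow_nonneg (hy0 _) p) (fun n => ?_) (hC N)
    · exact Real.rpow_le_rpow (hy0 _) (hy _ _ (by omega) (by omega)) hp.le
    · rw [one_mul]
      exact sum_rpow_le_of_le_one hp hp1 hψ hy0 hy n
  · set K : ℝ := p * (1 + C) with hK
    have hK0 : 0 < K := by positivity
    refine ⟨2 * (K * (2 * K) ^ (p - 1)), by positivity, fun y hy0 hy N => ?_⟩
    have hA0 := hardyAvg_nonneg hψ hy0
    have h1 := sum_hardyAvg_rpow_le (N := N) (v := v) (C := C)
      (h := fun i => y (i + 1) * hardyAvg ψ y (i + 1) ^ (p - 1)) hp hψ hΨpos hv hy0 hp.le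
      (fun i j hij => mul_le_mul (hy _ _ (by omega) (by omega))
        (Real.rpow_le_rpow (hA0 _) (antitone_hardyAvg_succ hψ hΨpos hy hij) (by linarith))
        (Real.rpow_nonneg (hA0 _) _) (hy0 _))
      (fun i => mul_nonneg (hy0 _) (Real.rpow_nonneg (hA0 _) _))
      (sum_rpow_le_of_one_le hp1 hψ hΨpos hy0) (hC N)
    have h2 : K * ∑ i ∈ Finset.range N, y (i + 1) * hardyAvg ψ y (i + 1) ^ (p - 1) * v (i + 1) ≤
        K * (2 * K) ^ (p - 1) * ∑ n ∈ Finset.range N, y (n + 1) ^ p * v (n + 1) +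
          (∑ n ∈ Finset.range N, hardyAvg ψ y (n + 1) ^ p * v (n + 1)) / 2 := by
      rw [Finset.mul_sum, Finset.mul_sum, Finset.sum_div, ← Finset.sum_add_distrib]
      refine Finset.sum_le_sum fun i _ => ?_
      have := mul_le_mul_of_nonneg_right
        (mul_mul_rpow_le hp1 hK0.le (hy0 (i + 1)) (hA0 (i + 1))) (hv (i + 1))
      linarith
    linarith

/-- Averages of the indicator of an initial segment. -/
lemma hardyAvg_indicator (ψ : ℕ → ℝ) (n j : ℕ) :
    hardyAvg ψ (fun k => if k ≤ n then 1 else 0) (n + j) = PsiSum ψ n / PsiSum ψ (n + j) := by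
  rw [hardyAvg, one_div_mul_eq_div]
  congr 1
  simp only [ite_mul, one_mul, zero_mul]
  rw [← Finset.sum_filter, PsiSum]
  refine Finset.sum_congr ?_ fun _ _ => rfl
  ext k
  simp only [Finset.mem_filter, Finset.mem_Icc]
  omega

/-- Characterization of the boundedness of the generalized discrete Hardy averaging
operator on the class of non-negative non-increasing sequences. -/
theorem stmt_4 (p : ℝ) (hp : 0 < p)
    (ψ : ℕ → ℝ) (hψ : ∀ k, 0 ≤ ψ k)
    (hΨpos : ∀ n : ℕ, 1 ≤ n → 0 < PsiSum ψ n)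
    (v : ℕ → ℝ) (hv : ∀ k, 0 ≤ v k) :
    (∃ C : ℝ, 0 < C ∧ ∀ y : ℕ → ℝ, (∀ k, 0 ≤ y k) →
        (∀ j k : ℕ, 1 ≤ j → j ≤ k → y k ≤ y j) →
        ∑' n : ℕ, ENNReal.ofReal ((hardyAvg ψ y (n + 1)) ^ p * v (n + 1)) ≤
          ENNReal.ofReal C * ∑' n : ℕ, ENNReal.ofReal ((y (n + 1)) ^ p * v (n + 1)))
    ↔
    (∃ C' : ℝ, 0 < C' ∧ ∀ n : ℕ, 1 ≤ n →
        ∑' j : ℕ, ENNReal.ofReal ((PsiSum ψ n / PsiSum ψ (n + j)) ^ p * v (n + j)) ≤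
          ENNReal.ofReal (C' * ∑ k ∈ Finset.Icc 1 n, v k)) := by
  constructor
  · rintro ⟨C, hC, h⟩
    refine ⟨C, hC, fun n hn => ?_⟩
    obtain ⟨m, rfl⟩ : ∃ m, n = m + 1 := ⟨n - 1, by omega⟩
    have hle := h (fun k => if k ≤ m + 1 then 1 else 0)
      (fun k => by split_ifs <;> norm_num)
      (fun j k _ hjk => by split_ifs <;> first | omega | norm_num)
    rw [ENNReal.ofReal_mul hC.le, sum_Icc_one_eq_sum_range,
      ENNReal.ofReal_sum_of_nonneg fun i _ => hv _]
    refine le_trans ?_ (hle.trans (le_of_eq ?_))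
    · refine le_trans (le_of_eq (tsum_congr fun j => ?_))
        (ENNReal.tsum_comp_le_tsum_of_injective (add_right_injective m) _)
      rw [← hardyAvg_indicator, show m + j + 1 = m + 1 + j by omega]
    · congr 1
      rw [tsum_eq_sum (s := Finset.range (m + 1)) fun k hk => by
        rw [Finset.mem_range] at hk
        rw [if_neg (by omega), Real.zero_rpow hp.ne', zero_mul, ENNReal.ofReal_zero]]
      refine Finset.sum_congr rfl fun i hi => ?_
      rw [Finset.mem_range] at hi
      rw [if_pos (by omega), Real.one_rpow, one_mul]
  · rintro ⟨C, hC, h⟩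
    have hterm : ∀ m k, 0 ≤ (PsiSum ψ m / PsiSum ψ k) ^ p * v k := fun m k =>
      mul_nonneg (Real.rpow_nonneg (div_nonneg (psiSum_nonneg hψ _) (psiSum_nonneg hψ _)) p) (hv _)
    obtain ⟨D, hD, hbound⟩ := exists_sum_hardyAvg_rpow_le hp hC hψ hΨpos hv (by
      intro N m
      have h1 := (ENNReal.sum_le_tsum (Finset.range (N - m))).trans (h (m + 1) (by omega))
      rw [← ENNReal.ofReal_sum_of_nonneg fun i _ => hterm _ _, ENNReal.ofReal_le_ofReal_iff
        (mul_nonneg hC.le (Finset.sum_nonneg fun _ _ => hv _)), sum_Icc_one_eq_sum_range] at h1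
      rw [Finset.sum_Ico_eq_sum_range]
      refine le_trans (le_of_eq (Finset.sum_congr rfl fun j _ => ?_)) h1
      rw [show m + j + 1 = m + 1 + j by omega])
    refine ⟨D, hD, fun y hy0 hy => ENNReal.tsum_le_of_sum_range_le fun N => ?_⟩
    rw [← ENNReal.ofReal_sum_of_nonneg fun i _ =>
      mul_nonneg (Real.rpow_nonneg (hardyAvg_nonneg hψ hy0 _) p) (hv _)]
    refine (ENNReal.ofReal_le_ofReal (hbound y hy0 hy N)).trans ?_
    rw [ENNReal.ofReal_mul hD.le, ENNReal.ofReal_sum_of_nonneg fun i _ =>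
      mul_nonneg (Real.rpow_nonneg (hy0 _) p) (hv _)]
    gcongr
    exact ENNReal.sum_le_tsum _
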